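/- Fix m ≥ 3. Let G be a graph obtained by wedging a (possibly one-vertex) tree T_i onto each vertex v_i of the complete graph K_m (the trees are pairwise disjoint, and for each i a chosen vertex of T_i is identified with v_i). Then G is ensnaring. -/

import Mathlib

open scoped Classical

/-- The state space `Ξₙ` for a graph on vertex set `V` with `n = |V|`: a state `(v, i, ε)`
consists of a bijection `v` from the vertices to the positions `ℤ/n` (the replica of vertex
`a` sits at position `v a`; positions increase clockwise), the index `i : ℤ/n`, and the
orientation `ε ∈ {±1}` encoded as a `Bool` (`true` = `+1`, `false` = `-1`). -/
abbrev Xi (V : Type*) [Fintype V] : Type _ :=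
  (V ≃ ZMod (Fintype.card V)) × ZMod (Fintype.card V) × Bool

/-- The orientation `ε` as an element of `ℤ/n`. -/
def epsZ (n : ℕ) (e : Bool) : ZMod n := if e then 1 else -1

/-- Refractive toric promotion `Θ_G`:
`Θ_G (v,i,ε) = (s̄ᵢ v, i+ε, ε)` if `{v⁻¹(i), v⁻¹(i+1)}` is not an edge of `G`, and
`Θ_G (v,i,ε) = (s̄ᵢ v, i−ε, −ε)` if it is an edge of `G`.  Here `s̄ᵢ v` swaps the replicas
sitting at positions `i` and `i+1`. -/
noncomputable def theta {V : Type*} [Fintype V] (G : SimpleGraph V) (D : Xi V) : Xi V :=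
  if G.Adj (D.1.symm D.2.1) (D.1.symm (D.2.1 + 1)) then
    (D.1.trans (Equiv.swap D.2.1 (D.2.1 + 1)), D.2.1 - epsZ _ D.2.2, !D.2.2)
  else
    (D.1.trans (Equiv.swap D.2.1 (D.2.1 + 1)), D.2.1 + epsZ _ D.2.2, D.2.2)

/-- The net number of clockwise steps that the replica of vertex `a` makes during one
application of `Θ_G` to the state `D`: each application swaps the replicas at positions
`i` and `i+1`, moving the former one step clockwise and the latter one step
counterclockwise. -/
def disp {V : Type*} [Fintype V] (D : Xi V) (a : V) : ℤ :=
  if D.1 a = D.2.1 then 1 else if D.1 a = D.2.1 + 1 then -1 else 0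

/-- `n` times the winding number `w_O(a)` of vertex `a` with respect to the orbit `O` of the
state `D` under `Θ_G`: the net number of clockwise steps made by the replica of `a` during
`P` consecutive applications of `Θ_G` starting from `D`, where `P` is the size of the orbit
(i.e. the minimal period of `D`).  The winding number itself is `windSum G D a / n`; in
particular `w_O(a) = 0` iff `windSum G D a = 0`, and `w_O(a) = w_O(b)` iff
`windSum G D a = windSum G D b`. -/
noncomputable def windSum {V : Type*} [Fintype V] (G : SimpleGraph V) (D : Xi V) (a : V) : ℤ :=
  ∑ k ∈ Finset.range (Function.minimalPeriod (theta G) D), disp ((theta G)^[k] D) a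

/-- The winding vector of the orbit of `D` under `Θ_G` is zero. -/
def WindingVectorZero {V : Type*} [Fintype V] (G : SimpleGraph V) (D : Xi V) : Prop :=
  ∀ a : V, windSum G D a = 0

/-- `G` is ensnaring if every orbit of `Θ_G` has winding vector `0`. -/
def Ensnaring {V : Type*} [Fintype V] (G : SimpleGraph V) : Prop :=
  ∀ D : Xi V, WindingVectorZero G D

/-- `G` is expelling if no orbit of `Θ_G` has winding vector `0`. -/
def Expelling {V : Type*} [Fintype V] (G : SimpleGraph V) : Prop :=
  ∀ D : Xi V, ¬ WindingVectorZero G D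

/-- The graph obtained from the complete graph `K_m` by wedging, for each `i`, the tree
`T i` (with chosen vertex `r i`) onto the `i`-th vertex of `K_m`.  The vertex `⟨i, r i⟩`
plays the role of the `i`-th vertex of `K_m`: two distinct vertices `⟨i, a⟩` and `⟨j, b⟩`
are adjacent iff `i = j` and `a, b` are adjacent in `T i`, or `i ≠ j` and `a = r i`,
`b = r j`. -/
def multiWedge (m : ℕ) (V : Fin m → Type*) (T : ∀ i, SimpleGraph (V i)) (r : ∀ i, V i) :
    SimpleGraph ((i : Fin m) × V i) :=
  SimpleGraph.fromRel (fun x y =>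
    (∃ h : x.1 = y.1, (T y.1).Adj (h ▸ x.2) y.2) ∨
      (x.1 ≠ y.1 ∧ x.2 = r x.1 ∧ y.2 = r y.1))


namespace RTP

/-- consistency of the floor matrix -/
structure FOK {V : Type*} (F : V → V → ℤ) : Prop where
  anti : ∀ a b, a ≠ b → F a b + F b a = -1
  tri : ∀ a b c, a ≠ b → b ≠ c → a ≠ c → F a b + F b c ≤ F a c ∧ F a c ≤ F a b + F b c + 1

structure FCross {V : Type*} (F : V → V → ℤ) (x y : V) (e : ℤ) (F' : V → V → ℤ) : Prop where
  ne : y ≠ x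
  sgn : e = 1 ∨ e = -1
  adjp : e = 1 → ∀ w, w ≠ x → w ≠ y → F y w = F x w + F y x
  adjm : e = -1 → ∀ w, w ≠ x → w ≠ y → F y w = F x w + F y x + 1
  up : F' x y = F x y + e
  dn : F' y x = F y x - e
  same : ∀ a b, a ≠ b → ¬ (a = x ∧ b = y) → ¬ (a = y ∧ b = x) → F' a b = F a b

def FStep {V : Type*} (G : SimpleGraph V) (F : V → V → ℤ) (x : V) (e : ℤ)
    (F' : V → V → ℤ) (x' : V) (e' : ℤ) : Prop :=
  ∃ y, FCross F x y e F' ∧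
    ((G.Adj x y ∧ x' = y ∧ e' = -e) ∨ (¬ G.Adj x y ∧ x' = x ∧ e' = e))

/-- Quantity for the bridge lemma. -/
noncomputable def RA {V : Type*} (U : Set V) (v b c : V) (F : V → V → ℤ) (x : V) : ℤ :=
  if x ∈ U then F v c - F v b - 1 else 2 * F b c - F v c + F v b

lemma RA_step {V : Type*} {G : SimpleGraph V} {F F' : V → V → ℤ} {x x' : V} {e e' : ℤ}
    (hF : FOK F) (h : FStep G F x e F' x' e')
    (U : Set V) (v b c : V) (hbc : b ≠ c) (hv : v ∉ U) (hb : b ∈ U) (hc : c ∈ U)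
    (hU : ∀ p q, p ∈ U → q ∉ U → G.Adj p q → q = v ∧ (p = b ∨ p = c))
    (hvb : G.Adj v b) (hvc : G.Adj v c) :
    RA U v b c F' x' = RA U v b c F x := by
  obtain ⟨y, hc', hh⟩ := h
  obtain ⟨hne, hs, hp, hm, hup, hdn, hsame⟩ := hc'
  have hvb' : v ≠ b := fun h => hv (h ▸ hb)
  have hvc' : v ≠ c := fun h => hv (h ▸ hc)
  have a1 := hF.anti b c hbc
  have a2 := hF.anti v b hvb'
  have a3 := hF.anti v c hvc'
  by_cases hx : x ∈ U
  · have hxv : x ≠ v := fun h => hv (h ▸ hx)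
    by_cases hyv : y = v ∧ (x = b ∨ x = c)
    · obtain ⟨rfl, rfl | rfl⟩ := hyv
      · have : x' = y ∧ e' = -e := by
          rcases hh with h | h
          · exact h.2
          · exact absurd hvb.symm h.1
        rw [this.1]
        simp only [RA, hx, hv, if_true, if_false]
        have s1 := hsame x c hbc (by grind) (by grind)
        have s2 := hsame y c hvc' (by grind) (by grind)
        rcases hs with rfl | rfl
        · have := hp rfl c hbc.symm hvc'.symm
          linarith
        · have := hm rfl c hbc.symm hvc'.symm
          linarith
      · have : x' = y ∧ e' = -e := by
          rcases hh with h | h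
          · exact h.2
          · exact absurd hvc.symm h.1
        rw [this.1]
        simp only [RA, hx, hv, if_true, if_false]
        have s1 := hsame b x hbc (by grind) (by grind)
        have s2 := hsame y b hvb' (by grind) (by grind)
        rcases hs with rfl | rfl
        · have := hp rfl b hbc hvb'.symm
          linarith
        · have := hm rfl b hbc hvb'.symm
          linarith
    · have hx' : x' ∈ U := by
        rcases hh with h | h
        · by_contra hn
          exact hyv (hU x y hx (h.2.1 ▸ hn) h.1)
        · exact h.2.1 ▸ hx
      simp only [RA, hx, hx', if_true]
      have s1 := hsame v c hvc' (by grind) (by grind)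
      have s2 := hsame v b hvb' (by grind) (by grind)
      rw [s1, s2]
  · have hxb : x ≠ b := fun h => hx (h ▸ hb)
    have hxc : x ≠ c := fun h => hx (h ▸ hc)
    have s0 := hsame b c hbc (by grind) (by grind)
    by_cases hyv : x = v ∧ (y = b ∨ y = c)
    · obtain ⟨rfl, rfl | rfl⟩ := hyv
      · have : x' = y ∧ e' = -e := by
          rcases hh with h | h
          · exact h.2
          · exact absurd hvb h.1
        rw [this.1]
        simp only [RA, hv, hb, if_true, if_false]
        have s2 := hsame x c hvc' (by grind) (by grind)
        rcases hs with rfl | rfl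
        · have := hp rfl c hvc'.symm hbc.symm
          linarith
        · have := hm rfl c hvc'.symm hbc.symm
          linarith
      · have : x' = y ∧ e' = -e := by
          rcases hh with h | h
          · exact h.2
          · exact absurd hvc h.1
        rw [this.1]
        simp only [RA, hv, hc, if_true, if_false]
        have s2 := hsame x b hvb' (by grind) (by grind)
        rcases hs with rfl | rfl
        · have := hp rfl b hvb'.symm hbc
          linarith
        · have := hm rfl b hvb'.symm hbc
          linarith
    · have hx' : x' ∉ U := by
        rcases hh with h | h
        · intro hn
          have := hU y x (h.2.1 ▸ hn) hx h.1.symm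
          exact hyv this
        · exact h.2.1 ▸ hx
      simp only [RA, hx, hx', if_false]
      have s1 := hsame v c hvc' (by grind) (by grind)
      have s2 := hsame v b hvb' (by grind) (by grind)
      rw [s1, s2, s0]

lemma RA_bound {V : Type*} {F : V → V → ℤ} (hF : FOK F) (U : Set V) (v b c x : V)
    (hbc : b ≠ c) (hvb : v ≠ b) (hvc : v ≠ c) :
    |F b c| ≤ |RA U v b c F x| + 3 := by
  have a2 := hF.anti v b hvb
  have t := hF.tri b v c hvb.symm hvc hbc
  unfold RA
  split_ifs
  · rcases abs_cases (F b c) with h | h <;> rcases abs_cases (F v c - F v b - 1) with h' | h' <;>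
      linarith
  · rcases abs_cases (F b c) with h | h <;>
      rcases abs_cases (2 * F b c - F v c + F v b) with h' | h' <;> linarith

/-- One-sided version: only one branch `B` attached to `v` through `d`. -/
noncomputable def RS {V : Type*} (B : Set V) (v d w : V) (F : V → V → ℤ) (x : V) : ℤ :=
  if x ∈ B then F v w - F v d - 1 else 2 * F d w - F v w + F v d

lemma RS_step {V : Type*} {G : SimpleGraph V} {F F' : V → V → ℤ} {x x' y : V} {e e' : ℤ}
    (hF : FOK F) (hc' : FCross F x y e F')
    (hh : (G.Adj x y ∧ x' = y ∧ e' = -e) ∨ (¬ G.Adj x y ∧ x' = x ∧ e' = e))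
    (B : Set V) (v d w : V) (hv : v ∉ B) (hd : d ∈ B) (hw : w ∉ B) (hwv : w ≠ v)
    (hB : ∀ p q, p ∈ B → q ∉ B → G.Adj p q → q = v ∧ p = d)
    (hvd : G.Adj v d) (hxw : x ≠ w) (hyw : ¬ (x = v ∧ y = w)) :
    RS B v d w F' x' = RS B v d w F x := by
  obtain ⟨hne, hs, hp, hm, hup, hdn, hsame⟩ := hc'
  have hvd' : v ≠ d := fun h => hv (h ▸ hd)
  have hdw : d ≠ w := fun h => hw (h ▸ hd)
  have a1 := hF.anti d w hdw
  have a2 := hF.anti v d hvd'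
  have a3 := hF.anti v w hwv.symm
  have s2 := hsame v w hwv.symm (by grind) (by grind)
  by_cases hx : x ∈ B
  · have hxv : x ≠ v := fun h => hv (h ▸ hx)
    by_cases hyv : y = v ∧ x = d
    · obtain ⟨rfl, rfl⟩ := hyv
      have : x' = y ∧ e' = -e := by
        rcases hh with h | h
        · exact h.2
        · exact absurd hvd.symm h.1
      rw [this.1]
      simp only [RS, hx, hv, if_true, if_false]
      have s1 := hsame x w hdw (by grind) (by grind)
      rcases hs with rfl | rfl
      · have := hp rfl w hdw.symm hwv
        linarith
      · have := hm rfl w hdw.symm hwv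
        linarith
    · have hx' : x' ∈ B := by
        rcases hh with h | h
        · by_contra hn
          exact hyv (hB x y hx (h.2.1 ▸ hn) h.1)
        · exact h.2.1 ▸ hx
      simp only [RS, hx, hx', if_true]
      have s1 := hsame v d hvd' (by grind) (by grind)
      rw [s1, s2]
  · have hxd : x ≠ d := fun h => hx (h ▸ hd)
    have s0 := hsame d w hdw (by grind) (by grind)
    by_cases hyv : x = v ∧ y = d
    · obtain ⟨rfl, rfl⟩ := hyv
      have : x' = y ∧ e' = -e := by
        rcases hh with h | h
        · exact h.2
        · exact absurd hvd h.1
      rw [this.1]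
      simp only [RS, hv, hd, if_true, if_false]
      rcases hs with rfl | rfl
      · have := hp rfl w hwv hdw.symm
        linarith
      · have := hm rfl w hwv hdw.symm
        linarith
    · have hx' : x' ∉ B := by
        rcases hh with h | h
        · intro hn
          have := hB y x (h.2.1 ▸ hn) hx h.1.symm
          exact hyv this
        · exact h.2.1 ▸ hx
      simp only [RS, hx, hx', if_false]
      have s1 := hsame v d hvd' (by grind) (by grind)
      rw [s1, s2, s0]

end RTP

namespace RTP

structure RootData {V ι : Type*} (G : SimpleGraph V) (ρ : ι → V) (tr : V → ι) (sg : V → ℤ) :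
    Prop where
  tr_root : ∀ i, tr (ρ i) = i
  cross : ∀ x y, G.Adj x y → tr x ≠ tr y → x = ρ (tr x) ∧ y = ρ (tr y)
  clique : ∀ i j, i ≠ j → G.Adj (ρ i) (ρ j)
  sg_root : ∀ i, sg (ρ i) = 1
  sg_flip : ∀ x y, G.Adj x y → tr x = tr y → sg y = - sg x

structure RootInv {V ι : Type*} (ρ : ι → V) (tr : V → ι) (sg : V → ℤ)
    (F : V → V → ℤ) (x : V) (e : ℤ) (L M R : ι) (s : ℤ) : Prop where
  hLM : L ≠ M
  hMR : M ≠ R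
  hLR : L ≠ R
  htr : tr x = M
  hs : e * sg x = s
  ML : F (ρ M) (ρ L) = 0
  RM : F (ρ R) (ρ M) = 0
  RL : F (ρ R) (ρ L) = 0
  wL : ∀ w, w ≠ L → w ≠ M → w ≠ R → F (ρ w) (ρ L) = 0
  wM : ∀ w, w ≠ L → w ≠ M → w ≠ R → F (ρ w) (ρ M) = 0
  wR : ∀ w, w ≠ L → w ≠ M → w ≠ R → F (ρ w) (ρ R) = 0

structure ChildInv {V ι : Type*} (ρ : ι → V)
    (F : V → V → ℤ) (x : V) (L M R : ι) (B : Set V) (a : ι) (d : V) (g δ : ℤ) : Prop where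
  out : a ≠ L → a ≠ M → a ≠ R → F (ρ a) d = g
  atR : a = R → F (ρ R) d = g + 2 * δ ∧ F (ρ L) d = g + δ
  atL : a = L → F (ρ L) d = g ∧ F (ρ R) d = g + δ
  atM : a = M → RS B (ρ M) d (ρ L) F x = -2 - g ∧ RS B (ρ M) d (ρ R) F x = -1 - g - 2 * δ

structure Branch {V : Type*} (G : SimpleGraph V) (B : Set V) (v d : V) : Prop where
  hv : v ∉ B
  hd : d ∈ B
  hB : ∀ p q, p ∈ B → q ∉ B → G.Adj p q → q = v ∧ p = d
  adj : G.Adj v d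

section
variable {V ι : Type*} {G : SimpleGraph V} {ρ : ι → V} {tr : V → ι} {sg : V → ℤ}

lemma RootData.inj (hD : RootData G ρ tr sg) {i j : ι} (h : i ≠ j) : ρ i ≠ ρ j := by
  intro h'
  apply h
  rw [← hD.tr_root i, ← hD.tr_root j, h']

/-- Steps which do not cross two roots. -/
lemma quiet (hD : RootData G ρ tr sg) {F F' : V → V → ℤ} {x x' y : V} {e e' : ℤ}
    (hF : FOK F) (hc : FCross F x y e F')
    (hh : (G.Adj x y ∧ x' = y ∧ e' = -e) ∨ (¬ G.Adj x y ∧ x' = x ∧ e' = e))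
    (hq : ¬ (G.Adj x y ∧ tr x ≠ tr y)) {L M R : ι} {s : ℤ}
    (hI : RootInv ρ tr sg F x e L M R s) : RootInv ρ tr sg F' x' e' L M R s := by
  have key : ∀ i j, i ≠ j → F' (ρ i) (ρ j) = F (ρ i) (ρ j) := by
    intro i j hij
    have adj := hD.clique i j hij
    apply hc.same _ _ (hD.inj hij)
    · rintro ⟨rfl, rfl⟩
      exact hq ⟨adj, by rwa [hD.tr_root, hD.tr_root]⟩
    · rintro ⟨rfl, rfl⟩
      exact hq ⟨adj.symm, by rw [hD.tr_root, hD.tr_root]; exact hij.symm⟩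
  obtain ⟨hLM, hMR, hLR, htr, hs, ML, RM, RL, wL, wM, wR⟩ := hI
  have h1 : tr x' = M ∧ e' * sg x' = s := by
    rcases hh with ⟨h, rfl, rfl⟩ | ⟨h, rfl, rfl⟩
    · have ht : tr x = tr x' := by
        by_contra hn
        exact hq ⟨h, hn⟩
      refine ⟨ht ▸ htr, ?_⟩
      rw [hD.sg_flip x x' h ht, ← hs]
      ring
    · exact ⟨htr, hs⟩
  refine ⟨hLM, hMR, hLR, h1.1, h1.2, ?_, ?_, ?_, ?_, ?_, ?_⟩
  · rw [key _ _ hLM.symm, ML]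
  · rw [key _ _ hMR.symm, RM]
  · rw [key _ _ hLR.symm, RL]
  · intro w h1 h2 h3
    rw [key _ _ h1, wL w h1 h2 h3]
  · intro w h1 h2 h3
    rw [key _ _ h2, wM w h1 h2 h3]
  · intro w h1 h2 h3
    rw [key _ _ h3, wR w h1 h2 h3]

/-- A root crossing from the middle root. -/
lemma which (hD : RootData G ρ tr sg) {F F' : V → V → ℤ} {e : ℤ} {j : ι} {L M R : ι} {s : ℤ}
    (hF : FOK F) (hc : FCross F (ρ M) (ρ j) e F')
    (hI : RootInv ρ tr sg F (ρ M) e L M R s) :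
    e = s ∧ ((s = 1 ∧ j = R) ∨ (s = -1 ∧ j = L)) := by
  obtain ⟨hLM, hMR, hLR, htr, hs, ML, RM, RL, wL, wM, wR⟩ := hI
  rw [hD.sg_root, mul_one] at hs
  refine ⟨hs, ?_⟩
  subst hs
  have hjM : j ≠ M := fun h => hc.ne (by rw [h])
  have a1 := hF.anti _ _ (hD.inj hLM)
  have a2 := hF.anti _ _ (hD.inj hMR)
  have a3 := hF.anti _ _ (hD.inj hLR)
  rcases hc.sgn with rfl | rfl
  · left
    refine ⟨rfl, ?_⟩
    by_contra hjR
    have h := hc.adjp rfl (ρ R) (hD.inj hMR.symm) (hD.inj (Ne.symm hjR))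
    by_cases hjL : j = L
    · subst hjL
      linarith
    · have := wM j hjL hjM hjR
      have := wR j hjL hjM hjR
      linarith
  · right
    refine ⟨rfl, ?_⟩
    by_contra hjL
    have h := hc.adjm rfl (ρ L) (hD.inj hLM) (hD.inj (Ne.symm hjL))
    by_cases hjR : j = R
    · subst hjR
      linarith
    · have := wM j hjL hjM hjR
      have := wL j hjL hjM hjR
      linarith

lemma hitR (hD : RootData G ρ tr sg) {F F' : V → V → ℤ} {L M R : ι}
    (hF : FOK F) (hF' : FOK F') (hc : FCross F (ρ M) (ρ R) 1 F')
    (hI : RootInv ρ tr sg F (ρ M) 1 L M R 1) :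
    RootInv ρ tr sg F' (ρ R) (-1) L R M (-1) := by
  obtain ⟨hLM, hMR, hLR, htr, hs, ML, RM, RL, wL, wM, wR⟩ := hI
  have a2 := hF.anti _ _ (hD.inj hMR)
  have key : ∀ i j, i ≠ j → ¬ (i = M ∧ j = R) → ¬ (i = R ∧ j = M) →
      F' (ρ i) (ρ j) = F (ρ i) (ρ j) := by
    intro i j hij h1 h2
    apply hc.same _ _ (hD.inj hij)
    · rintro ⟨h3, h4⟩
      apply h1
      constructor <;> by_contra hn
      · exact hD.inj hn h3
      · exact hD.inj hn h4
    · rintro ⟨h3, h4⟩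
      apply h2
      constructor <;> by_contra hn
      · exact hD.inj hn h3
      · exact hD.inj hn h4
  refine ⟨hLR, hMR.symm, hLM, hD.tr_root _, by rw [hD.sg_root]; norm_num, ?_, ?_, ?_, ?_, ?_, ?_⟩
  · rw [key _ _ hLR.symm (by grind) (by grind), RL]
  · have := hc.up
    linarith
  · rw [key _ _ hLM.symm (by grind) (by grind), ML]
  · intro w h1 h2 h3
    rw [key _ _ h1 (by grind) (by grind), wL w h1 h3 h2]
  · intro w h1 h2 h3
    rw [key _ _ h2 (by grind) (by grind), wR w h1 h3 h2]
  · intro w h1 h2 h3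
    rw [key _ _ h3 (by grind) (by grind), wM w h1 h3 h2]

lemma hitL (hD : RootData G ρ tr sg) {F F' : V → V → ℤ} {L M R : ι}
    (hF : FOK F) (hF' : FOK F') (hc : FCross F (ρ M) (ρ L) (-1) F')
    (hI : RootInv ρ tr sg F (ρ M) (-1) L M R (-1)) :
    RootInv ρ tr sg F' (ρ L) 1 M L R 1 := by
  obtain ⟨hLM, hMR, hLR, htr, hs, ML, RM, RL, wL, wM, wR⟩ := hI
  have a2 := hF.anti _ _ (hD.inj hLM)
  have key : ∀ i j, i ≠ j → ¬ (i = M ∧ j = L) → ¬ (i = L ∧ j = M) →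
      F' (ρ i) (ρ j) = F (ρ i) (ρ j) := by
    intro i j hij h1 h2
    apply hc.same _ _ (hD.inj hij)
    · rintro ⟨h3, h4⟩
      apply h1
      constructor <;> by_contra hn
      · exact hD.inj hn h3
      · exact hD.inj hn h4
    · rintro ⟨h3, h4⟩
      apply h2
      constructor <;> by_contra hn
      · exact hD.inj hn h3
      · exact hD.inj hn h4
  refine ⟨hLM.symm, hLR, hMR, hD.tr_root _, by rw [hD.sg_root]; norm_num, ?_, ?_, ?_, ?_, ?_, ?_⟩
  · have := hc.dn
    linarith
  · rw [key _ _ hLR.symm (by grind) (by grind), RL]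
  · rw [key _ _ hMR.symm (by grind) (by grind), RM]
  · intro w h1 h2 h3
    rw [key _ _ h1 (by grind) (by grind), wM w h2 h1 h3]
  · intro w h1 h2 h3
    rw [key _ _ h2 (by grind) (by grind), wL w h2 h1 h3]
  · intro w h1 h2 h3
    rw [key _ _ h3 (by grind) (by grind), wR w h2 h1 h3]

lemma root_step (hD : RootData G ρ tr sg) {F F' : V → V → ℤ} {x x' : V} {e e' : ℤ}
    (hF : FOK F) (hF' : FOK F') (h : FStep G F x e F' x' e') {L M R : ι} {s : ℤ}
    (hI : RootInv ρ tr sg F x e L M R s) {B : Set V} {a : ι} {d : V}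
    (hBr : Branch G B (ρ a) d) (had : tr d = a) (hBn : ∀ i, ρ i ∉ B) {g δ : ℤ}
    (hC : ChildInv ρ F x L M R B a d g δ) :
    ∃ L' M' R' s', RootInv ρ tr sg F' x' e' L' M' R' s' ∧
      ChildInv ρ F' x' L' M' R' B a d g δ := by
  obtain ⟨y, hc, hh⟩ := h
  have hdne : ∀ i, ρ i ≠ d := fun i h => hBn i (h ▸ hBr.hd)
  by_cases hq : G.Adj x y ∧ tr x ≠ tr y
  · obtain ⟨hxy, htr⟩ := hq
    have hx := (hD.cross x y hxy htr).1
    have hy := (hD.cross x y hxy htr).2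
    rw [hI.htr] at hx
    obtain ⟨j, rfl⟩ : ∃ j, y = ρ j := ⟨_, hy⟩
    subst hx
    obtain ⟨rfl, rfl⟩ : x' = ρ j ∧ e' = -e := by
      rcases hh with h | h
      · exact h.2
      · exact absurd hxy h.1
    have sd : ∀ i, F' (ρ i) d = F (ρ i) d := by
      intro i
      apply hc.same _ _ (hdne i)
      · exact fun h => hdne _ h.2.symm
      · exact fun h => hdne _ h.2.symm
    have ad : ∀ i, F d (ρ i) = -1 - F (ρ i) d := fun i => by
      have := hF.anti _ _ (hdne i)
      linarith
    have ad' : ∀ i, F' d (ρ i) = -1 - F (ρ i) d := fun i => by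
      have := hF'.anti _ _ (hdne i)
      rw [sd] at this
      linarith
    obtain ⟨rfl, ⟨rfl, rfl⟩ | ⟨rfl, rfl⟩⟩ := which hD hF hc hI
    · have hI' := hitR hD hF hF' hc hI
      refine ⟨L, j, M, -1, hI', ?_⟩
      have A := hc.adjp rfl d (hdne _).symm (hdne _).symm
      rw [hI.RM, add_zero] at A
      have b1 := hF.anti _ _ (hD.inj hI.hLM)
      have b2 := hF.anti _ _ (hD.inj hI.hMR)
      have b1' := hF'.anti _ _ (hD.inj hI'.hLM)
      have b2' := hF'.anti _ _ (hD.inj hI'.hMR)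
      have e1 := hI.ML
      have e2 := hI.RM
      have e1' := hI'.ML
      have e2' := hI'.RM
      obtain ⟨h1, h2, h3, h4⟩ := hC
      simp only [RS, hBn, if_false, ad] at h4
      constructor
      · intro k1 k2 k3
        rw [sd, h1 k1 k3 k2]
      · intro k
        have := h4 k
        rw [sd, sd]
        constructor <;> linarith
      · intro k
        have := h3 k
        rw [sd, sd]
        constructor <;> linarith
      · intro k
        have := h2 k
        simp only [RS, hBn, if_false, ad', sd]
        constructor <;> linarith
    · have hI' := hitL hD hF hF' hc hI
      rw [neg_neg]
      refine ⟨M, j, R, 1, hI', ?_⟩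
      have A := hc.adjm rfl d (hdne _).symm (hdne _).symm
      have b1 := hF.anti _ _ (hD.inj hI.hLM)
      have b2 := hF.anti _ _ (hD.inj hI.hMR)
      have b1' := hF'.anti _ _ (hD.inj hI'.hLM)
      have b2' := hF'.anti _ _ (hD.inj hI'.hMR)
      have e1 := hI.ML
      have e2 := hI.RM
      have e1' := hI'.ML
      have e2' := hI'.RM
      obtain ⟨h1, h2, h3, h4⟩ := hC
      simp only [RS, hBn, if_false, ad] at h4
      constructor
      · intro k1 k2 k3
        rw [sd, h1 k2 k1 k3]
      · intro k
        have := h2 k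
        rw [sd, sd]
        constructor <;> linarith
      · intro k
        have := h4 k
        rw [sd, sd]
        constructor <;> linarith
      · intro k
        have := h3 k
        simp only [RS, hBn, if_false, ad', sd]
        constructor <;> linarith
  · refine ⟨L, M, R, s, quiet hD hF hc hh hq hI, ?_⟩
    have hroot : ∀ i, i ≠ M → x ≠ ρ i := by
      rintro i hi rfl
      exact hi (by rw [← hI.htr, hD.tr_root])
    have sd : ∀ i, i ≠ M → a ≠ M → F' (ρ i) d = F (ρ i) d := by
      intro i hi ha
      apply hc.same _ _ (hdne i)
      · exact fun h => hroot i hi h.1.symm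
      · rintro ⟨-, rfl⟩
        exact ha (by rw [← hI.htr, had])
    obtain ⟨h1, h2, h3, h4⟩ := hC
    constructor
    · intro k1 k2 k3
      rw [sd _ k2 k2, h1 k1 k2 k3]
    · intro k
      have ha : a ≠ M := k ▸ hI.hMR.symm
      rw [sd _ hI.hMR.symm ha, sd _ hI.hLM ha]
      exact h2 k
    · intro k
      have ha : a ≠ M := k ▸ hI.hLM
      rw [sd _ hI.hMR.symm ha, sd _ hI.hLM ha]
      exact h3 k
    · intro k
      subst k
      have nq : ∀ i, i ≠ a → ¬ (x = ρ a ∧ y = ρ i) := by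
        rintro i hi ⟨rfl, rfl⟩
        exact hq ⟨hD.clique _ _ hi.symm, by rw [hD.tr_root, hD.tr_root]; exact hi.symm⟩
      rw [RS_step hF hc hh B (ρ a) d (ρ L) hBr.hv hBr.hd (hBn L) (hD.inj hI.hLM) hBr.hB hBr.adj
          (hroot _ hI.hLM) (nq _ hI.hLM),
        RS_step hF hc hh B (ρ a) d (ρ R) hBr.hv hBr.hd (hBn R) (hD.inj hI.hMR.symm) hBr.hB hBr.adj
          (hroot _ hI.hMR.symm) (nq _ hI.hMR.symm)]
      exact h4 rfl

lemma child_init (hD : RootData G ρ tr sg) {F : V → V → ℤ} {x : V} {e : ℤ}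
    (hF : FOK F) {L M R : ι} {s : ℤ}
    (hI : RootInv ρ tr sg F x e L M R s) {B : Set V} {a : ι} {d : V}
    (hBn : ∀ i, ρ i ∉ B) (hd : d ∈ B) :
    ∃ g δ, ChildInv ρ F x L M R B a d g δ := by
  have hdne : ∀ i, ρ i ≠ d := fun i h => hBn i (h ▸ hd)
  have b1 := hF.anti _ _ (hD.inj hI.hLM)
  have b2 := hF.anti _ _ (hD.inj hI.hMR)
  have e1 := hI.ML
  have e2 := hI.RM
  have h1 := hI.hLM
  have h2 := hI.hMR
  have h3 := hI.hLR
  by_cases hR : a = R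
  · refine ⟨2 * F (ρ L) d - F (ρ R) d, F (ρ R) d - F (ρ L) d, ?_, ?_, ?_, ?_⟩
    · intro _ _ h; exact absurd hR h
    · intro _; constructor <;> ring
    · intro h; exact absurd (h.symm.trans hR) h3
    · intro h; exact absurd (h.symm.trans hR) h2
  by_cases hL : a = L
  · refine ⟨F (ρ L) d, F (ρ R) d - F (ρ L) d, ?_, ?_, ?_, ?_⟩
    · intro h; exact absurd hL h
    · intro h; exact absurd h hR
    · intro _; constructor <;> ring
    · intro h; exact absurd (hL.symm.trans h) h1
  by_cases hM : a = M
  · by_cases hx : x ∈ B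
    · refine ⟨F (ρ M) d - 1, 1, ?_, ?_, ?_, ?_⟩
      · intro _ h; exact absurd hM h
      · intro h; exact absurd h hR
      · intro h; exact absurd h hL
      · intro _
        simp only [RS, hx, if_true]
        constructor <;> linarith
    · refine ⟨2 * F (ρ L) d - F (ρ M) d, F (ρ R) d - F (ρ L) d, ?_, ?_, ?_, ?_⟩
      · intro _ h; exact absurd hM h
      · intro h; exact absurd h hR
      · intro h; exact absurd h hL
      · intro _
        have := hF.anti _ _ (hdne L)
        have := hF.anti _ _ (hdne R)
        simp only [RS, hx, if_false]
        constructor <;> linarith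
  · exact ⟨F (ρ a) d, 0, fun _ _ _ => rfl, fun h => absurd h hR, fun h => absurd h hL,
      fun h => absurd h hM⟩

lemma child_bound (hD : RootData G ρ tr sg) {F : V → V → ℤ} {x : V} {e : ℤ}
    (hF : FOK F) {L M R : ι} {s : ℤ}
    (hI : RootInv ρ tr sg F x e L M R s) {B : Set V} {a : ι} {d : V}
    (hBn : ∀ i, ρ i ∉ B) (hd : d ∈ B) {g δ : ℤ} (hC : ChildInv ρ F x L M R B a d g δ) :
    |F (ρ a) d| ≤ |g| + 2 * |δ| + 2 := by
  have hdne : ∀ i, ρ i ≠ d := fun i h => hBn i (h ▸ hd)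
  have b1 := hF.anti _ _ (hD.inj hI.hLM)
  have e1 := hI.ML
  have g1 := neg_abs_le g
  have g2 := le_abs_self g
  have g3 := neg_abs_le δ
  have g4 := le_abs_self δ
  have g5 := abs_nonneg δ
  rw [abs_le]
  by_cases hR : a = R
  · have := (hC.atR hR).1
    subst hR
    constructor <;> linarith
  by_cases hL : a = L
  · have := (hC.atL hL).1
    subst hL
    constructor <;> linarith
  by_cases hM : a = M
  · have := (hC.atM hM).1
    subst hM
    by_cases hx : x ∈ B
    · simp only [RS, hx, if_true] at this
      constructor <;> linarith
    · have h1 := hF.anti _ _ (hdne L)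
      have t := hF.tri _ _ _ (hD.inj hI.hLM) (hdne a) (hdne L)
      simp only [RS, hx, if_false] at this
      constructor <;> linarith
  · have := hC.out hL hM hR
    constructor <;> linarith

lemma roots_bound (hD : RootData G ρ tr sg) {F : V → V → ℤ} {x : V} {e : ℤ}
    (hF : FOK F) {L M R : ι} {s : ℤ}
    (hI : RootInv ρ tr sg F x e L M R s) (i j : ι) (hij : i ≠ j) : |F (ρ i) (ρ j)| ≤ 3 := by
  have key : ∀ w, w ≠ L → F (ρ w) (ρ L) = 0 := by
    intro w hw
    by_cases h1 : w = M
    · rw [h1, hI.ML]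
    by_cases h2 : w = R
    · rw [h2, hI.RL]
    exact hI.wL w hw h1 h2
  have key2 : ∀ w, w ≠ L → F (ρ L) (ρ w) = -1 := by
    intro w hw
    have := hF.anti _ _ (hD.inj hw)
    have := key w hw
    linarith
  rw [abs_le]
  by_cases hi : i = L
  · subst hi
    rw [key2 j hij.symm]; norm_num
  by_cases hj : j = L
  · subst hj
    rw [key i hij]; norm_num
  have t := hF.tri _ _ _ (hD.inj hi) (hD.inj (Ne.symm hj)) (hD.inj hij)
  rw [key i hi, key2 j hj] at t
  constructor <;> linarith

end

end RTP

namespace RTP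

lemma fl {n k q : ℤ} (hn : 0 < n) (h1 : n * q ≤ k) (h2 : k < n * q + n) : k / n = q := by
  have e := Int.mul_ediv_add_emod k n
  have e1 := Int.emod_nonneg k hn.ne'
  have e2 := Int.emod_lt_of_pos k hn
  have a1 : n * (k / n) < n * (q + 1) := by linarith
  have a2 : n * q < n * (k / n + 1) := by linarith
  have := lt_of_mul_lt_mul_left a1 hn.le
  have := lt_of_mul_lt_mul_left a2 hn.le
  omega

lemma fl_succ {n k : ℤ} (hn : 0 < n) (h : ¬ n ∣ k + 1) : (k + 1) / n = k / n := by
  have e := Int.mul_ediv_add_emod k n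
  have e1 := Int.emod_nonneg k hn.ne'
  have e2 := Int.emod_lt_of_pos k hn
  apply fl hn
  · linarith
  · rcases lt_or_eq_of_le (Int.add_one_le_of_lt e2) with h' | h'
    · linarith
    · exfalso
      apply h
      refine ⟨k / n + 1, ?_⟩
      linarith

lemma fl_pred {n k : ℤ} (hn : 0 < n) (h : ¬ n ∣ k) : (k - 1) / n = k / n := by
  have := fl_succ (k := k - 1) hn (by simpa using h)
  simpa using this.symm

def InjMod {V : Type*} (n : ℤ) (X : V → ℤ) : Prop := ∀ a b, a ≠ b → ¬ n ∣ X a - X b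

def FF {V : Type*} (n : ℤ) (X : V → ℤ) (a b : V) : ℤ := (X a - X b) / n

lemma FF_ok {V : Type*} {n : ℤ} (hn : 0 < n) {X : V → ℤ} (hX : InjMod n X) : FOK (FF n X) := by
  have base : ∀ a b, n * FF n X a b ≤ X a - X b ∧ X a - X b < n * FF n X a b + n := by
    intro a b
    have e := Int.mul_ediv_add_emod (X a - X b) n
    have e1 := Int.emod_nonneg (X a - X b) hn.ne'
    have e2 := Int.emod_lt_of_pos (X a - X b) hn
    unfold FF
    constructor <;> linarith
  constructor
  · intro a b hab
    have h1 := base a b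
    have h2 : n * FF n X a b ≠ X a - X b := fun h => hX a b hab ⟨_, h.symm⟩
    have h3 := lt_of_le_of_ne h1.1 h2
    have : FF n X b a = - FF n X a b - 1 := by
      apply fl hn <;> linarith
    linarith
  · intro a b c hab hbc hac
    have h1 := base a b
    have h2 := base b c
    have h3 := base a c
    constructor
    · have : n * (FF n X a b + FF n X b c) < n * (FF n X a c + 1) := by linarith
      have := lt_of_mul_lt_mul_left this hn.le
      linarith
    · have : n * FF n X a c < n * (FF n X a b + FF n X b c + 2) := by linarith
      have := lt_of_mul_lt_mul_left this hn.le
      linarith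

lemma FF_cross {V : Type*} {n : ℤ} (hn : 2 ≤ n) {X X' : V → ℤ} (hX : InjMod n X) {x y : V} {e : ℤ}
    (hne : y ≠ x) (he : e = 1 ∨ e = -1) (hxy : n ∣ X y - X x - e)
    (h1 : X' x = X x + e) (h2 : X' y = X y - e) (h3 : ∀ a, a ≠ x → a ≠ y → X' a = X a) :
    FCross (FF n X) x y e (FF n X') := by
  have hn0 : 0 < n := by linarith
  obtain ⟨s, hs⟩ := hxy
  have hy : X y = X x + e + n * s := by linarith
  have dv : ∀ k, n ∣ k + n * s ↔ n ∣ k := fun k => by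
    constructor
    · intro h
      have := dvd_sub h (Dvd.intro s rfl)
      simpa using this
    · intro h
      exact dvd_add h (Dvd.intro s rfl)
  refine ⟨hne, he, ?_, ?_, ?_, ?_, ?_⟩
  · rintro rfl w hwx hwy
    have q1 : FF n X y x = s := by
      unfold FF
      apply fl hn0 <;> linarith
    have q2 : FF n X y w = (X x - X w + 1) / n + s := by
      unfold FF
      rw [hy, ← Int.add_mul_ediv_left _ _ hn0.ne']
      congr 1
      ring
    have nd : ¬ n ∣ X x - X w + 1 := by
      intro h
      apply hX y w hwy.symm
      rw [hy, show X x + 1 + n * s - X w = (X x - X w + 1) + n * s by ring, dv]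
      exact h
    rw [q1, q2, fl_succ hn0 nd]
    rfl
  · rintro rfl w hwx hwy
    have q1 : FF n X y x = s - 1 := by
      unfold FF
      apply fl hn0 <;> linarith
    have q2 : FF n X y w = (X x - X w - 1) / n + s := by
      unfold FF
      rw [hy, ← Int.add_mul_ediv_left _ _ hn0.ne']
      congr 1
      ring
    rw [q1, q2, fl_pred hn0 (hX x w hwx.symm)]
    unfold FF
    ring
  · rcases he with rfl | rfl
    · have q1 : FF n X x y = -s - 1 := by
        unfold FF
        apply fl hn0 <;> linarith
      have q2 : FF n X' x y = -s := by
        unfold FF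
        apply fl hn0 <;> linarith
      rw [q1, q2]; ring
    · have q1 : FF n X x y = -s := by
        unfold FF
        apply fl hn0 <;> linarith
      have q2 : FF n X' x y = -s - 1 := by
        unfold FF
        apply fl hn0 <;> linarith
      rw [q1, q2]; ring
  · rcases he with rfl | rfl
    · have q1 : FF n X y x = s := by
        unfold FF
        apply fl hn0 <;> linarith
      have q2 : FF n X' y x = s - 1 := by
        unfold FF
        apply fl hn0 <;> linarith
      rw [q1, q2]
    · have q1 : FF n X y x = s - 1 := by
        unfold FF
        apply fl hn0 <;> linarith
      have q2 : FF n X' y x = s := by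
        unfold FF
        apply fl hn0 <;> linarith
      rw [q1, q2]; ring
  · intro a b hab hn1 hn2
    -- not (x + e ≡ w), not (w + e ≡ y)
    have n1 : ∀ w, w ≠ x → w ≠ y → ¬ n ∣ X x - X w + e := by
      intro w _ hwy h
      apply hX y w hwy.symm
      rw [hy, show X x + e + n * s - X w = (X x - X w + e) + n * s by ring, dv]
      exact h
    have n2 : ∀ w, w ≠ x → w ≠ y → ¬ n ∣ X y - X w - e := by
      intro w hwx _ h
      apply hX x w hwx.symm
      rw [hy, show X x + e + n * s - X w - e = (X x - X w) + n * s by ring, dv] at h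
      exact h
    have neg : ∀ p q : ℤ, ¬ n ∣ p → q = -p → ¬ n ∣ q := by
      rintro p q h rfl h'
      exact h ((dvd_neg).1 h')
    unfold FF
    by_cases ax : a = x
    · have hb : b ≠ x := fun h => hab (ax.trans h.symm)
      have hby : b ≠ y := fun h => hn1 ⟨ax, h⟩
      rw [ax, h1, h3 b hb hby]
      rcases he with rfl | rfl
      · rw [← fl_succ hn0 (n1 b hb hby)]
        congr 1; ring
      · rw [← fl_pred hn0 (hX x b hb.symm)]
        congr 1; ring
    by_cases ay : a = y
    · have hb : b ≠ y := fun h => hab (ay.trans h.symm)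
      have hbx : b ≠ x := fun h => hn2 ⟨ay, h⟩
      rw [ay, h2, h3 b hbx hb]
      rcases he with rfl | rfl
      · rw [← fl_pred hn0 (hX y b hb.symm)]
        congr 1; ring
      · rw [← fl_succ (k := X y - X b) hn0 (by simpa using n2 b hbx hb)]
        congr 1; ring
    rw [h3 a ax ay]
    by_cases bx : b = x
    · rw [bx, h1]
      rcases he with rfl | rfl
      · rw [← fl_pred hn0 (hX a x ax)]
        congr 1; ring
      · rw [← fl_succ (k := X a - X x) hn0 (neg _ _ (n1 a ax ay) (by ring))]
        congr 1; ring
    by_cases byy : b = y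
    · rw [byy, h2]
      rcases he with rfl | rfl
      · rw [← fl_succ (k := X a - X y) hn0 (neg _ _ (n2 a ax ay) (by ring))]
        congr 1; ring
      · rw [← fl_pred hn0 (hX a y ay)]
        congr 1; ring
    rw [h3 b bx byy]

section
variable {V : Type*} [Fintype V]

noncomputable def act (D : Xi V) : V :=
  if D.2.2 then D.1.symm D.2.1 else D.1.symm (D.2.1 + 1)

noncomputable def oth (D : Xi V) : V :=
  if D.2.2 then D.1.symm (D.2.1 + 1) else D.1.symm D.2.1

def eps (D : Xi V) : ℤ := if D.2.2 then 1 else -1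

def Valid (D : Xi V) (X : V → ℤ) : Prop := ∀ a, ((X a : ℤ) : ZMod (Fintype.card V)) = D.1 a

lemma Valid.injMod {D : Xi V} {X : V → ℤ} (h : Valid D X) : InjMod (Fintype.card V : ℤ) X := by
  intro a b hab hd
  apply hab
  apply D.1.injective
  rw [← h a, ← h b]
  have := (ZMod.intCast_zmod_eq_zero_iff_dvd (X a - X b) (Fintype.card V)).2 hd
  rwa [Int.cast_sub, sub_eq_zero] at this

lemma one_ne (hn : 2 ≤ Fintype.card V) (i : ZMod (Fintype.card V)) : i + 1 ≠ i := by
  intro h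
  have h1 : (1 : ZMod (Fintype.card V)) = 0 := by simpa using h
  have : Fact (1 < Fintype.card V) := ⟨hn⟩
  exact one_ne_zero h1

lemma theta_fst (G : SimpleGraph V) (D : Xi V) :
    (theta G D).1 = D.1.trans (Equiv.swap D.2.1 (D.2.1 + 1)) := by
  unfold theta
  split_ifs <;> rfl

lemma valid_step (hn : 2 ≤ Fintype.card V) (G : SimpleGraph V) {D : Xi V} {X : V → ℤ}
    (h : Valid D X) : Valid (theta G D) (fun a => X a + disp D a) := by
  intro a
  have h1 := one_ne hn D.2.1
  rw [theta_fst]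
  simp only [Equiv.trans_apply, Int.cast_add, h a, disp]
  split_ifs with h2 h3
  · rw [h2, Equiv.swap_apply_left]; simp
  · rw [h3, Equiv.swap_apply_right]; simp
  · rw [Equiv.swap_apply_of_ne_of_ne h2 h3]; simp

lemma step_step (hn : 2 ≤ Fintype.card V) (G : SimpleGraph V) {D : Xi V} {X : V → ℤ}
    (h : Valid D X) :
    FStep G (FF (Fintype.card V) X) (act D) (eps D)
      (FF (Fintype.card V) (fun a => X a + disp D a)) (act (theta G D)) (eps (theta G D)) := by
  have h1 := one_ne hn D.2.1
  refine ⟨oth D, ?_, ?_⟩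
  · apply FF_cross (by exact_mod_cast hn) h.injMod
    · unfold oth act
      split_ifs
      · intro h'; exact h1 (D.1.symm.injective h')
      · intro h'; exact h1 (D.1.symm.injective h').symm
    · unfold eps; split_ifs <;> simp
    · rw [← ZMod.intCast_zmod_eq_zero_iff_dvd]
      push_cast
      rw [h, h]
      unfold oth act eps
      split_ifs <;> simp
    · unfold act eps disp
      split_ifs <;> simp_all
    · unfold oth eps disp
      split_ifs <;> simp_all
      ring
    · intro a ha hb
      have k1 : D.1 a ≠ D.2.1 := by
        intro h'
        have : a = D.1.symm D.2.1 := by rw [← h', Equiv.symm_apply_apply]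
        unfold act at ha
        unfold oth at hb
        split_ifs at ha hb
        · exact ha this
        · exact hb this
      have k2 : D.1 a ≠ D.2.1 + 1 := by
        intro h'
        have : a = D.1.symm (D.2.1 + 1) := by rw [← h', Equiv.symm_apply_apply]
        unfold act at ha
        unfold oth at hb
        split_ifs at ha hb
        · exact hb this
        · exact ha this
      simp [disp, k1, k2]
  · obtain ⟨v, i, b⟩ := D
    simp only at h1
    have e1 : i - 1 ≠ i := fun h => h1 (by linear_combination -h)
    by_cases hadj : G.Adj (v.symm i) (v.symm (i + 1))
    · left
      cases b
      · simp [act, oth, eps, theta, hadj, hadj.symm, epsZ]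
      · simp [act, oth, eps, theta, hadj, hadj.symm, epsZ]
    · right
      have hadj' : ¬ G.Adj (v.symm (i + 1)) (v.symm i) := fun h => hadj h.symm
      cases b
      · simp [act, oth, eps, theta, hadj, hadj', epsZ]
      · simp [act, oth, eps, theta, hadj, hadj', epsZ]

/-- lifted trajectory -/
noncomputable def lift (G : SimpleGraph V) (D : Xi V) (X : V → ℤ) (t : ℕ) (a : V) : ℤ :=
  X a + ∑ k ∈ Finset.range t, disp ((theta G)^[k] D) a

lemma lift_valid (hn : 2 ≤ Fintype.card V) (G : SimpleGraph V) {D : Xi V} {X : V → ℤ}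
    (h : Valid D X) (t : ℕ) : Valid ((theta G)^[t] D) (lift G D X t) := by
  induction t with
  | zero => simpa [lift, Valid] using h
  | succ t ih =>
    rw [Function.iterate_succ_apply']
    have := valid_step hn G ih
    convert this using 2
    simp [lift, Finset.sum_range_succ, add_assoc]

lemma lift_step (hn : 2 ≤ Fintype.card V) (G : SimpleGraph V) {D : Xi V} {X : V → ℤ}
    (h : Valid D X) (t : ℕ) :
    FStep G (FF (Fintype.card V) (lift G D X t)) (act ((theta G)^[t] D)) (eps ((theta G)^[t] D))
      (FF (Fintype.card V) (lift G D X (t + 1))) (act ((theta G)^[t + 1] D))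
      (eps ((theta G)^[t + 1] D)) := by
  have := step_step hn G (lift_valid hn G h t)
  rw [Function.iterate_succ_apply']
  convert this using 2
  funext a
  simp [lift, Finset.sum_range_succ, add_assoc]

lemma sum_mul_period {α : Type*} (f : α → α) (x : α) (φ : α → ℤ) (k : ℕ) :
    ∑ i ∈ Finset.range (k * Function.minimalPeriod f x), φ (f^[i] x) =
      k * ∑ i ∈ Finset.range (Function.minimalPeriod f x), φ (f^[i] x) := by
  induction k with
  | zero => simp
  | succ k ih =>
    rw [add_mul, one_mul, Finset.sum_range_add, ih]
    have : ∀ i, f^[k * Function.minimalPeriod f x + i] x = f^[i] x := by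
      intro i
      rw [add_comm, Function.iterate_add_apply]
      congr 1
      exact (Function.isPeriodicPt_minimalPeriod f x).const_mul k
    simp only [this]
    push_cast
    ring

lemma wind_eq (hn : 2 ≤ Fintype.card V) (G : SimpleGraph V) {D : Xi V} {X : V → ℤ}
    (a b : V) (K : ℤ)
    (hK : ∀ t, |FF (Fintype.card V) (lift G D X t) a b| ≤ K) :
    windSum G D a = windSum G D b := by
  set n : ℤ := (Fintype.card V : ℤ) with hnn
  have hn0 : 0 < n := by rw [hnn]; exact_mod_cast (by linarith : 0 < Fintype.card V)
  by_contra hne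
  set w := windSum G D a - windSum G D b with hw
  have hw0 : w ≠ 0 := sub_ne_zero.2 hne
  have hb : ∀ k : ℕ, |(X a - X b) + k * w| ≤ n * K + n := by
    intro k
    have h := hK (k * Function.minimalPeriod (theta G) D)
    have e : lift G D X (k * Function.minimalPeriod (theta G) D) a -
        lift G D X (k * Function.minimalPeriod (theta G) D) b = (X a - X b) + k * w := by
      unfold lift
      rw [sum_mul_period (theta G) D (fun D => disp D a), sum_mul_period (theta G) D (fun D => disp D b), hw]
      unfold windSum
      ring
    unfold FF at h
    rw [e] at h
    set q := (X a - X b) + k * w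
    have e0 := Int.mul_ediv_add_emod q n
    have e1 := Int.emod_nonneg q hn0.ne'
    have e2 := Int.emod_lt_of_pos q hn0
    rw [abs_le] at h ⊢
    have m1 := mul_le_mul_of_nonneg_left h.1 hn0.le
    have m2 := mul_le_mul_of_nonneg_left h.2 hn0.le
    constructor <;> linarith
  have hKK : 0 ≤ n * K + n := (abs_nonneg _).trans (hb 0)
  have h0 := hb 0
  have h1 := hb (2 * (n * K + n).toNat + 1)
  push_cast at h0 h1
  rw [Int.toNat_of_nonneg hKK] at h1
  set A := n * K + n
  have : |(2 * A + 1) * w| ≤ 2 * A := by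
    have := abs_sub (X a - X b + (2 * A + 1) * w) (X a - X b + 0 * w)
    have e : (2 * A + 1) * w = (X a - X b + (2 * A + 1) * w) - (X a - X b + 0 * w) := by ring
    rw [e]
    linarith
  rw [abs_mul, abs_of_nonneg (by linarith : 0 ≤ 2 * A + 1)] at this
  have : 1 ≤ |w| := Int.one_le_abs hw0
  nlinarith

lemma sum_wind (hn : 2 ≤ Fintype.card V) (G : SimpleGraph V) (D : Xi V) :
    ∑ a, windSum G D a = 0 := by
  unfold windSum
  rw [Finset.sum_comm]
  apply Finset.sum_eq_zero
  intro k _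
  set E := (theta G)^[k] D
  have h1 := one_ne hn E.2.1
  have : ∀ a, disp E a = (if a = E.1.symm E.2.1 then 1 else 0) -
      (if a = E.1.symm (E.2.1 + 1) then 1 else 0) := by
    intro a
    simp only [disp, Equiv.eq_symm_apply]
    split_ifs <;> simp_all
  simp [this]

end

end RTP

namespace RTP

def side {V : Type*} (G : SimpleGraph V) (v d : V) : Set V :=
  {z | (G.deleteEdges {s(v, d)}).Reachable d z}

lemma branch_of_bridge {V : Type*} {G : SimpleGraph V} {v d : V} (hadj : G.Adj v d)
    (hb : G.IsBridge s(v, d)) : Branch G (side G v d) v d := by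
  rw [SimpleGraph.isBridge_iff] at hb
  refine ⟨fun h => hb h.symm, SimpleGraph.Reachable.refl _, ?_, hadj⟩
  intro p q hp hq hpq
  by_cases he : s(p, q) = s(v, d)
  · rcases Sym2.eq_iff.1 he with ⟨rfl, rfl⟩ | ⟨rfl, rfl⟩
    · exact absurd hp (fun h => hb h.symm)
    · exact ⟨rfl, rfl⟩
  · exfalso
    apply hq
    have h' : (G.deleteEdges {s(v, d)}).Adj p q := by
      rw [SimpleGraph.deleteEdges_adj]
      exact ⟨hpq, by simpa using he⟩
    exact SimpleGraph.Reachable.trans hp h'.reachable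

lemma side_not_mem {V : Type*} {G : SimpleGraph V} {v d w : V}
    (hb : G.IsBridge s(v, d)) (hw : G.Adj v w) (hwd : w ≠ d) : w ∉ side G v d := by
  intro h
  rw [SimpleGraph.isBridge_iff] at hb
  apply hb
  have h' : (G.deleteEdges {s(v, d)}).Adj v w := by
    rw [SimpleGraph.deleteEdges_adj]
    refine ⟨hw, ?_⟩
    simp only [Set.mem_singleton_iff, Sym2.eq_iff]
    rintro (h | h)
    · exact hwd h.2
    · exact hw.ne h.2.symm
  exact h'.reachable.trans h.symm

section
variable {V : Type*} [Fintype V]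

lemma exists_valid (D : Xi V) : ∃ X, Valid D X := by
  have : ∀ a, ∃ k : ℤ, (k : ZMod (Fintype.card V)) = D.1 a := fun a => ZMod.intCast_surjective _
  choose X hX using this
  exact ⟨X, hX⟩

lemma FOK_lift (hn : 2 ≤ Fintype.card V) (G : SimpleGraph V) {D : Xi V} {X : V → ℤ}
    (h : Valid D X) (t : ℕ) : FOK (FF (Fintype.card V) (lift G D X t)) :=
  FF_ok (by exact_mod_cast (by linarith : 0 < Fintype.card V)) (lift_valid hn G h t).injMod

lemma wind_nbrs (hn : 2 ≤ Fintype.card V) (G : SimpleGraph V) (D : Xi V) (v b c : V)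
    (h1 : G.Adj v b) (h2 : G.Adj v c) (b1 : G.IsBridge s(v, b)) (b2 : G.IsBridge s(v, c)) :
    windSum G D b = windSum G D c := by
  by_cases hbc : b = c
  · rw [hbc]
  obtain ⟨X, hX⟩ := exists_valid D
  obtain ⟨p1, p2, p3, p4⟩ := branch_of_bridge h1 b1
  obtain ⟨q1, q2, q3, q4⟩ := branch_of_bridge h2 b2
  set U := side G v b ∪ side G v c
  have key : ∀ t, RA U v b c (FF (Fintype.card V) (lift G D X t)) (act ((theta G)^[t] D)) =
      RA U v b c (FF (Fintype.card V) (lift G D X 0)) (act ((theta G)^[0] D)) := by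
    intro t
    induction t with
    | zero => rfl
    | succ t ih =>
      rw [← ih]
      apply RA_step (FOK_lift hn G hX t) (lift_step hn G hX t) U v b c hbc
      · rintro (h | h)
        · exact p1 h
        · exact q1 h
      · exact Or.inl p2
      · exact Or.inr q2
      · rintro p q (hp | hp) hq hpq
        · have := p3 p q hp (fun h => hq (Or.inl h)) hpq
          exact ⟨this.1, Or.inl this.2⟩
        · have := q3 p q hp (fun h => hq (Or.inr h)) hpq
          exact ⟨this.1, Or.inr this.2⟩
      · exact h1
      · exact h2
  apply wind_eq hn G (X := X) b c
    (|RA U v b c (FF (Fintype.card V) (lift G D X 0)) (act ((theta G)^[0] D))| + 3)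
  intro t
  have := RA_bound (FOK_lift hn G hX t) U v b c (act ((theta G)^[t] D)) hbc h1.ne h2.ne
  rwa [key t] at this

lemma root_init {ι : Type*} [Fintype ι] (hι : 3 ≤ Fintype.card ι) (hn : 2 ≤ Fintype.card V)
    {G : SimpleGraph V} {ρ : ι → V}
    {tr : V → ι} {sg : V → ℤ} (hD : RootData G ρ tr sg) (D : Xi V) :
    ∃ X L M R s, Valid D X ∧ RootInv ρ tr sg (FF (Fintype.card V) X) (act D) (eps D) L M R s := by
  have : NeZero (Fintype.card V) := ⟨by linarith⟩
  set n : ℤ := (Fintype.card V : ℤ) with hnn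
  have hn0 : 0 < n := by rw [hnn]; exact_mod_cast (by linarith : 0 < Fintype.card V)
  set M := tr (act D) with hM
  set c : ℤ := ((D.1 (ρ M)).val : ℤ)
  set Y : V → ℤ := fun a => ((D.1 a - D.1 (ρ M)).val : ℤ) + c with hY
  have hYv : Valid D Y := by
    intro a
    simp [hY, c]
  have hYM : Y (ρ M) = c := by simp [hY]
  have hYl : ∀ a, c ≤ Y a := by
    intro a
    have h0 : (0:ℤ) ≤ ((D.1 a - D.1 (ρ M)).val : ℤ) := Int.natCast_nonneg _
    simp only [hY]
    linarith
  have hYu : ∀ a, Y a < c + n := by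
    intro a
    have hv := ZMod.val_lt (D.1 a - D.1 (ρ M))
    have hv2 : ((D.1 a - D.1 (ρ M)).val : ℤ) < n := by
      rw [hnn]
      exact Int.ofNat_lt.2 hv
    simp only [hY]
    linarith
  have hYi : ∀ i j, i ≠ j → Y (ρ i) ≠ Y (ρ j) := by
    intro i j hij h
    apply hYv.injMod _ _ (hD.inj hij)
    rw [h, sub_self]
    exact dvd_zero _
  have hcard : 2 ≤ (Finset.univ.erase M).card := by
    rw [Finset.card_erase_of_mem (Finset.mem_univ _), Finset.card_univ]
    omega
  have hne : (Finset.univ.erase M).Nonempty := Finset.card_pos.1 (by omega)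
  obtain ⟨R, hR, hRm⟩ := Finset.exists_min_image (Finset.univ.erase M) (fun i => Y (ρ i)) hne
  obtain ⟨L, hL, hLm⟩ := Finset.exists_max_image (Finset.univ.erase M) (fun i => Y (ρ i)) hne
  have hRM : R ≠ M := Finset.ne_of_mem_erase hR
  have hLM : L ≠ M := Finset.ne_of_mem_erase hL
  have hLR : L ≠ R := by
    rintro rfl
    obtain ⟨i, hi, hiL⟩ := Finset.exists_mem_ne (by omega : 1 < (Finset.univ.erase M).card) L
    exact hYi i L hiL (le_antisymm (hLm i hi) (hRm i hi))
  set X : V → ℤ := fun a => if a = ρ L then Y a - n else Y a with hX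
  have hXv : Valid D X := by
    intro a
    simp only [hX]
    split_ifs
    · push_cast
      rw [hYv a, hnn]
      simp
    · exact hYv a
  have XL : X (ρ L) = Y (ρ L) - n := by simp [hX]
  have Xo : ∀ i, i ≠ L → X (ρ i) = Y (ρ i) := by
    intro i hi
    simp [hX, hD.inj hi]
  have lt1 : ∀ i, i ≠ M → i ≠ R → Y (ρ R) < Y (ρ i) := fun i h1 h2 =>
    lt_of_le_of_ne (hRm i (by simp [h1])) (hYi _ _ h2.symm)
  have lt2 : ∀ i, i ≠ M → i ≠ L → Y (ρ i) < Y (ρ L) := fun i h1 h2 =>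
    lt_of_le_of_ne (hLm i (by simp [h1])) (hYi _ _ h2)
  have bd : ∀ i, c ≤ Y (ρ i) ∧ Y (ρ i) < c + n := fun i => ⟨hYl _, hYu _⟩
  refine ⟨X, L, M, R, eps D * sg (act D), hXv, hLM, hRM.symm, hLR, hM.symm, rfl, ?_, ?_, ?_, ?_, ?_, ?_⟩
  · have := bd L
    have hc : c < Y (ρ L) := lt_of_le_of_ne (hYl _) (by rw [← hYM]; exact hYi _ _ hLM.symm)
    unfold FF
    rw [XL, Xo M hLM.symm, hYM]
    apply fl hn0 <;> linarith
  · have := bd R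
    unfold FF
    rw [Xo M hLM.symm, Xo R hLR.symm, hYM]
    apply fl hn0 <;> linarith
  · have := bd R
    have := bd L
    have := lt2 R hRM hLR.symm
    unfold FF
    rw [XL, Xo R hLR.symm]
    apply fl hn0 <;> linarith
  · intro w h1 h2 h3
    have := bd w
    have := bd L
    have := lt2 w h2 h1
    unfold FF
    rw [XL, Xo w h1]
    apply fl hn0 <;> linarith
  · intro w h1 h2 h3
    have := bd w
    unfold FF
    rw [Xo M hLM.symm, Xo w h1, hYM]
    apply fl hn0 <;> linarith
  · intro w h1 h2 h3
    have := bd w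
    have := bd R
    have := lt1 w h2 h3
    unfold FF
    rw [Xo R hLR.symm, Xo w h1]
    apply fl hn0 <;> linarith

lemma wind_child {ι : Type*} [Fintype ι] (hι : 3 ≤ Fintype.card ι) (hn : 2 ≤ Fintype.card V)
    {G : SimpleGraph V} {ρ : ι → V}
    {tr : V → ι} {sg : V → ℤ} (hD : RootData G ρ tr sg) (D : Xi V) (a : ι) (d : V)
    (had : G.Adj (ρ a) d) (hb : G.IsBridge s(ρ a, d)) (htr : tr d = a) :
    windSum G D (ρ a) = windSum G D d ∧ ∀ i j, windSum G D (ρ i) = windSum G D (ρ j) := by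
  obtain ⟨X, L, M, R, s, hX, hI⟩ := root_init hι hn hD D
  have hBr := branch_of_bridge had hb
  have hdr : ∀ i, ρ i ≠ d := by
    rintro i rfl
    rw [hD.tr_root] at htr
    subst htr
    exact had.ne rfl
  have hBn : ∀ i, ρ i ∉ side G (ρ a) d := by
    intro i
    by_cases hi : i = a
    · rw [hi]; exact hBr.hv
    · exact side_not_mem hb (hD.clique a i (Ne.symm hi)) (hdr i)
  have hF0 : FOK (FF (Fintype.card V) X) :=
    FF_ok (by exact_mod_cast (by linarith : 0 < Fintype.card V)) hX.injMod
  obtain ⟨g, δ, hC⟩ := child_init hD hF0 hI (a := a) hBn hBr.hd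
  have key : ∀ t, ∃ L M R s, RootInv ρ tr sg (FF (Fintype.card V) (lift G D X t))
      (act ((theta G)^[t] D)) (eps ((theta G)^[t] D)) L M R s ∧
      ChildInv ρ (FF (Fintype.card V) (lift G D X t)) (act ((theta G)^[t] D)) L M R
        (side G (ρ a) d) a d g δ := by
    intro t
    induction t with
    | zero =>
      have : lift G D X 0 = X := by funext a; simp [lift]
      rw [this]
      exact ⟨L, M, R, s, hI, hC⟩
    | succ t ih =>
      obtain ⟨L, M, R, s, h1, h2⟩ := ih
      exact root_step hD (FOK_lift hn G hX t) (FOK_lift hn G hX (t + 1)) (lift_step hn G hX t) h1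
        hBr htr hBn h2
  constructor
  · apply wind_eq hn G (X := X) _ _ (|g| + 2 * |δ| + 2)
    intro t
    obtain ⟨L, M, R, s, h1, h2⟩ := key t
    exact child_bound hD (FOK_lift hn G hX t) h1 hBn hBr.hd h2
  · intro i j
    by_cases hij : i = j
    · rw [hij]
    apply wind_eq hn G (X := X) _ _ 3
    intro t
    obtain ⟨L, M, R, s, h1, h2⟩ := key t
    exact roots_bound hD (FOK_lift hn G hX t) h1 i j hij

end

lemma root_step' {V ι : Type*} {G : SimpleGraph V} {ρ : ι → V} {tr : V → ι} {sg : V → ℤ}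
    (hD : RootData G ρ tr sg) {F F' : V → V → ℤ} {x x' : V} {e e' : ℤ}
    (hF : FOK F) (hF' : FOK F') (h : FStep G F x e F' x' e') {L M R : ι} {s : ℤ}
    (hI : RootInv ρ tr sg F x e L M R s) :
    ∃ L' M' R' s', RootInv ρ tr sg F' x' e' L' M' R' s' := by
  obtain ⟨y, hc, hh⟩ := h
  by_cases hq : G.Adj x y ∧ tr x ≠ tr y
  · obtain ⟨hxy, htr⟩ := hq
    have hx := (hD.cross x y hxy htr).1
    have hy := (hD.cross x y hxy htr).2
    rw [hI.htr] at hx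
    obtain ⟨j, rfl⟩ : ∃ j, y = ρ j := ⟨_, hy⟩
    subst hx
    obtain ⟨rfl, rfl⟩ : x' = ρ j ∧ e' = -e := by
      rcases hh with h | h
      · exact h.2
      · exact absurd hxy h.1
    obtain ⟨rfl, ⟨rfl, rfl⟩ | ⟨rfl, rfl⟩⟩ := which hD hF hc hI
    · exact ⟨L, j, M, -1, hitR hD hF hF' hc hI⟩
    · rw [neg_neg]
      exact ⟨M, j, R, 1, hitL hD hF hF' hc hI⟩
  · exact ⟨L, M, R, s, quiet hD hF hc hh hq hI⟩

lemma wind_roots {V : Type*} [Fintype V] {ι : Type*} [Fintype ι] (hι : 3 ≤ Fintype.card ι)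
    (hn : 2 ≤ Fintype.card V) {G : SimpleGraph V} {ρ : ι → V}
    {tr : V → ι} {sg : V → ℤ} (hD : RootData G ρ tr sg) (D : Xi V) (i j : ι) :
    windSum G D (ρ i) = windSum G D (ρ j) := by
  obtain ⟨X, L, M, R, s, hX, hI⟩ := root_init hι hn hD D
  have key : ∀ t, ∃ L M R s, RootInv ρ tr sg (FF (Fintype.card V) (lift G D X t))
      (act ((theta G)^[t] D)) (eps ((theta G)^[t] D)) L M R s := by
    intro t
    induction t with
    | zero =>
      have : lift G D X 0 = X := by funext a; simp [lift]
      rw [this]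
      exact ⟨L, M, R, s, hI⟩
    | succ t ih =>
      obtain ⟨L, M, R, s, h1⟩ := ih
      exact root_step' hD (FOK_lift hn G hX t) (FOK_lift hn G hX (t + 1)) (lift_step hn G hX t) h1
  by_cases hij : i = j
  · rw [hij]
  apply wind_eq hn G (X := X) _ _ 3
  intro t
  obtain ⟨L, M, R, s, h1⟩ := key t
  exact roots_bound hD (FOK_lift hn G hX t) h1 i j hij

section
variable {m : ℕ} {V : Fin m → Type*} {T : ∀ i, SimpleGraph (V i)} {r : ∀ i, V i}

lemma mw_same {i : Fin m} {a b : V i} :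
    (multiWedge m V T r).Adj ⟨i, a⟩ ⟨i, b⟩ ↔ (T i).Adj a b := by
  simp only [multiWedge, SimpleGraph.fromRel_adj]
  constructor
  · rintro ⟨-, (⟨h, h'⟩ | h) | (⟨h, h'⟩ | h)⟩
    · exact h'
    · exact absurd rfl h.1
    · exact h'.symm
    · exact absurd rfl h.1
  · intro h
    refine ⟨?_, Or.inl (Or.inl ⟨trivial, h⟩)⟩
    intro h'
    have := eq_of_heq (Sigma.mk.inj h').2
    exact h.ne this

lemma mw_ne {i j : Fin m} (hij : i ≠ j) {a : V i} {b : V j} :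
    (multiWedge m V T r).Adj ⟨i, a⟩ ⟨j, b⟩ ↔ a = r i ∧ b = r j := by
  simp only [multiWedge, SimpleGraph.fromRel_adj]
  constructor
  · rintro ⟨-, (⟨h, h'⟩ | h) | (⟨h, h'⟩ | h)⟩
    · exact absurd h hij
    · exact h.2
    · exact absurd h.symm hij
    · exact ⟨h.2.2, h.2.1⟩
  · intro h
    refine ⟨?_, Or.inl (Or.inr ⟨hij, h⟩)⟩
    intro h'
    exact hij (Sigma.mk.inj h').1

lemma mw_bridge (hT : ∀ i, (T i).IsTree) {i : Fin m} {u v : V i} (h : (T i).Adj u v) :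
    (multiWedge m V T r).IsBridge s(⟨i, u⟩, ⟨i, v⟩) := by
  rw [SimpleGraph.isBridge_iff]
  intro hr
  have hbr : (T i).IsBridge s(u, v) :=
    SimpleGraph.isAcyclic_iff_forall_isBridge.1 (hT i).isAcyclic h
  rw [SimpleGraph.isBridge_iff] at hbr
  let π : ((j : Fin m) × V j) → V i := fun x => if h : x.1 = i then h ▸ x.2 else r i
  have πi : ∀ a : V i, π ⟨i, a⟩ = a := fun a => by simp [π]
  have πn : ∀ j (a : V j), j ≠ i → π ⟨j, a⟩ = r i := fun j a hj => by simp [π, hj]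
  have key : ∀ z, ((multiWedge m V T r).deleteEdges {s(⟨i, u⟩, ⟨i, v⟩)}).Reachable ⟨i, u⟩ z →
      ((T i).deleteEdges {s(u, v)}).Reachable u (π z) := by
    intro z hz
    rw [SimpleGraph.reachable_iff_reflTransGen] at hz
    induction hz with
    | refl => rw [πi]
    | @tail y z _ hyz ih =>
      rw [SimpleGraph.deleteEdges_adj] at hyz
      obtain ⟨hadj, hne⟩ := hyz
      obtain ⟨j, y⟩ := y
      obtain ⟨k, z⟩ := z
      by_cases hjk : j = k
      · subst hjk
        by_cases hj : j = i
        · subst hj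
          rw [πi] at ih ⊢
          apply ih.trans
          apply SimpleGraph.Adj.reachable
          rw [SimpleGraph.deleteEdges_adj]
          refine ⟨mw_same.1 hadj, ?_⟩
          intro hh
          apply hne
          rw [Set.mem_singleton_iff] at hh ⊢
          rcases Sym2.eq_iff.1 hh with ⟨rfl, rfl⟩ | ⟨rfl, rfl⟩
          · rfl
          · exact Sym2.eq_swap
        · rw [πn _ _ hj] at ih ⊢
          exact ih
      · obtain ⟨rfl, rfl⟩ := (mw_ne hjk).1 hadj
        have : ∀ l, π ⟨l, r l⟩ = r i := by
          intro l
          by_cases hl : l = i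
          · subst hl; rw [πi]
          · rw [πn _ _ hl]
        rw [this] at ih ⊢
        exact ih
  have := key _ hr
  rw [πi] at this
  exact hbr this

lemma mw_data (hT : ∀ i, (T i).IsTree) :
    ∃ sg, RootData (multiWedge m V T r) (fun i => (⟨i, r i⟩ : (i : Fin m) × V i)) Sigma.fst sg := by
  refine ⟨fun x => if (hT x.1).coloringTwo x.2 = (hT x.1).coloringTwo (r x.1) then 1 else -1,
    fun i => rfl, ?_, ?_, ?_, ?_⟩
  · rintro ⟨i, a⟩ ⟨j, b⟩ h hij
    have hij' : i ≠ j := hij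
    obtain ⟨h1, h2⟩ := (mw_ne hij').1 h
    subst h1
    subst h2
    exact ⟨rfl, rfl⟩
  · intro i j hij
    exact (mw_ne hij).2 ⟨rfl, rfl⟩
  · intro i
    simp
  · rintro ⟨i, a⟩ ⟨j, b⟩ h hij
    simp only at hij
    subst hij
    have h' := (hT i).coloringTwo.valid (mw_same.1 h)
    simp only
    generalize (hT i).coloringTwo a = p at *
    generalize (hT i).coloringTwo b = q at *
    generalize (hT i).coloringTwo (r i) = s at *
    revert p q s
    decide

end

end RTP

open RTP in
/-- Fix `m ≥ 3`.  A graph obtained by wedging a (possibly one-vertex)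
tree onto each vertex of the complete graph `K_m` is ensnaring. -/
theorem stmt_11 (m : ℕ) (hm : 3 ≤ m) (V : Fin m → Type*) [∀ i, Fintype (V i)]
    (T : ∀ i, SimpleGraph (V i)) (hT : ∀ i, (T i).IsTree) (r : ∀ i, V i) :
    Ensnaring (multiWedge m V T r) := by
  intro D
  set G := multiWedge m V T r with hG
  obtain ⟨sg, hD⟩ := mw_data (r := r) hT
  have hι : 3 ≤ Fintype.card (Fin m) := by simpa using hm
  have hn : 2 ≤ Fintype.card ((i : Fin m) × V i) := by
    have := Fintype.card_le_of_injective (fun i => (⟨i, r i⟩ : (i : Fin m) × V i))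
      (fun i j h => (Sigma.mk.inj h).1)
    omega
  have hP : ∀ i (v : V i), windSum G D ⟨i, v⟩ = windSum G D ⟨i, r i⟩ ∧
      ∀ b, (T i).Adj v b → windSum G D ⟨i, b⟩ = windSum G D ⟨i, v⟩ := by
    intro i v
    have hr := (hT i).connected.preconnected (r i) v
    rw [SimpleGraph.reachable_iff_reflTransGen] at hr
    induction hr with
    | refl =>
      refine ⟨rfl, fun b hb => ?_⟩
      exact (wind_child hι hn hD D i ⟨i, b⟩ (mw_same.2 hb) (mw_bridge hT hb) rfl).1.symm
    | @tail y z _ hyz ih =>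
      have h1 := ih.2 z hyz
      refine ⟨h1.trans ih.1, fun b hb => ?_⟩
      rw [h1]
      exact wind_nbrs hn G D ⟨i, z⟩ ⟨i, b⟩ ⟨i, y⟩ (mw_same.2 hb) (mw_same.2 hyz.symm)
        (mw_bridge hT hb) (mw_bridge hT hyz.symm)
  have hall : ∀ x y, windSum G D x = windSum G D y := by
    rintro ⟨i, a⟩ ⟨j, b⟩
    rw [(hP i a).1, (hP j b).1]
    exact wind_roots hι hn hD D i j
  intro a
  have hs := sum_wind hn G D
  rw [Finset.sum_congr rfl (fun x _ => hall x a), Finset.sum_const, Finset.card_univ,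
    nsmul_eq_mul] at hs
  rcases mul_eq_zero.1 hs with h | h
  · have : Fintype.card ((i : Fin m) × V i) = 0 := by exact_mod_cast h
    omega
  · exact h
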